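/- Let E be a real inner product space, f : E → ℝ, and let x* ∈ E be a global minimizer of f with f* = f(x*). Let (μ_k)_{k ≥ 0} be positive reals with μ_0 = μ and μ_k ≤ μ_{k−1} for all k ≥ 1. Let (λ_k) be the Nesterov sequence λ_0 = 1, λ_{k+1} = (1 + √(1 + 4 λ_k²))/2. Let (x_k), (y_k) be sequences in E with y_0 = x_0 and (ε_k) nonnegative reals satisfying: (i) for every k ≥ 0 and every z ∈ E, f(z) ≥ f(y_{k+1}) + μ_k⟨x_k − y_{k+1}, z − y_{k+1}⟩ − ε_k; (ii) x_{k+1} = y_{k+1} + ((λ_k − 1)/λ_{k+1})(y_{k+1} − y_k) for all k ≥ 0. Then for every k ≥ 1, with R = ‖x_0 − x*‖, f(y_k) − f* ≤ 2μR²/(k+1)² + (1/λ_{k−1}²) Σ_{i=0}^{k−1} λ_i² ε_i. -/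

import Mathlib

open RealInnerProductSpace

/-- One step of the accelerated inexact proximal point method, with `a = λ_k`, `m = μ_k` and
`e = ε_k`; the point `y` is the current iterate and `y'` the next one. -/
theorem accelerated_prox_step {E : Type*} [NormedAddCommGroup E] [InnerProductSpace ℝ E]
    (f : E → ℝ) {x y y' p : E} {m a e : ℝ} (hm : 0 ≤ m) (ha : 1 ≤ a)
    (hsub : ∀ z : E, f z ≥ f y' + m * ⟪x - y', z - y'⟫ - e) :
    a ^ 2 * (f y' - f p) + m / 2 * ‖a • y' - (a - 1) • y - p‖ ^ 2 ≤
      (a ^ 2 - a) * (f y - f p) + m / 2 * ‖a • x - (a - 1) • y - p‖ ^ 2 + a ^ 2 * e := by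
  set w' := a • y' - (a - 1) • y - p with hw'
  set w := a • x - (a - 1) • y - p with hw
  have hinner : a * ((a - 1) * ⟪x - y', y - y'⟫ + ⟪x - y', p - y'⟫) = - ⟪w - w', w'⟫ := by
    have hdiff : w - w' = a • (x - y') := by rw [hw, hw']; module
    have hneg : w' = -((a - 1) • (y - y') + (p - y')) := by rw [hw']; module
    rw [hdiff, hneg, inner_neg_right, inner_add_right, real_inner_smul_left,
      real_inner_smul_left, real_inner_smul_right]
    ring
  have hpolar : ‖w‖ ^ 2 = ‖w - w'‖ ^ 2 + 2 * ⟪w - w', w'⟫ + ‖w'‖ ^ 2 := by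
    rw [← norm_add_sq_real, sub_add_cancel]
  have hy := mul_le_mul_of_nonneg_left (hsub y) (mul_nonneg (by linarith : 0 ≤ a) (sub_nonneg.2 ha))
  have hp := mul_le_mul_of_nonneg_left (hsub p) (by linarith : 0 ≤ a)
  have hnorm : 0 ≤ m * ‖w - w'‖ ^ 2 := by positivity
  linear_combination hy + hp + hnorm / 2 - m * hinner - m / 2 * hpolar

theorem nesterov_sq_sub_self {lam : ℕ → ℝ}
    (hrec : ∀ k : ℕ, lam (k + 1) = (1 + Real.sqrt (1 + 4 * lam k ^ 2)) / 2) (k : ℕ) :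
    lam (k + 1) ^ 2 - lam (k + 1) = lam k ^ 2 := by
  have hsqrt := Real.sq_sqrt (by positivity : 0 ≤ 1 + 4 * lam k ^ 2)
  rw [hrec k]
  linear_combination hsqrt / 4

theorem nesterov_lower_bound {lam : ℕ → ℝ} (h0 : lam 0 = 1)
    (hrec : ∀ k : ℕ, lam (k + 1) = (1 + Real.sqrt (1 + 4 * lam k ^ 2)) / 2) (k : ℕ) :
    ((k : ℝ) + 2) / 2 ≤ lam k := by
  induction k with
  | zero => simp [h0]
  | succ k ih =>
    have hsqrt : 2 * lam k ≤ Real.sqrt (1 + 4 * lam k ^ 2) := Real.le_sqrt_of_sq_le (by linarith)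
    rw [hrec k]
    push_cast
    linarith

theorem stmt_10 {E : Type*} [NormedAddCommGroup E] [InnerProductSpace ℝ E]
    (f : E → ℝ) (xstar : E) (hstar : ∀ z, f xstar ≤ f z)
    (μ : ℝ) (mu : ℕ → ℝ) (hmu : ∀ k, 0 < mu k) (hmu0 : mu 0 = μ)
    (hmudec : ∀ k : ℕ, 1 ≤ k → mu k ≤ mu (k - 1))
    (lam : ℕ → ℝ) (h0 : lam 0 = 1)
    (hrec : ∀ k : ℕ, lam (k + 1) = (1 + Real.sqrt (1 + 4 * lam k ^ 2)) / 2)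
    (x y : ℕ → E) (hinit : y 0 = x 0) (eps : ℕ → ℝ) (heps : ∀ k, 0 ≤ eps k)
    (hsub : ∀ k : ℕ, ∀ z : E,
      f z ≥ f (y (k + 1)) + mu k * ⟪x k - y (k + 1), z - y (k + 1)⟫ - eps k)
    (hupd : ∀ k : ℕ,
      x (k + 1) = y (k + 1) + ((lam k - 1) / lam (k + 1)) • (y (k + 1) - y k)) :
    ∀ k : ℕ, 1 ≤ k →
      f (y k) - f xstar ≤ 2 * μ * ‖x 0 - xstar‖ ^ 2 / ((k : ℝ) + 1) ^ 2 +
        (1 / lam (k - 1) ^ 2) * ∑ i ∈ Finset.range k, lam i ^ 2 * eps i := by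
  have hlb := nesterov_lower_bound h0 hrec
  have hone : ∀ k, 1 ≤ lam k := fun k => by
    linarith [hlb k, (Nat.cast_nonneg k : (0 : ℝ) ≤ k)]
  have hstep := fun k => accelerated_prox_step f (y := y k) (p := xstar) (hmu k).le (hone k) (hsub k)
  have hextrap : ∀ k, lam (k + 1) • x (k + 1) - (lam (k + 1) - 1) • y (k + 1) - xstar =
      lam k • y (k + 1) - (lam k - 1) • y k - xstar := fun k => by
    rw [hupd k, smul_add, smul_smul, mul_div_cancel₀ _ (by linarith [hone (k + 1)])]
    module
  have hpot : ∀ k, lam k ^ 2 * (f (y (k + 1)) - f xstar) +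
      mu k / 2 * ‖lam k • y (k + 1) - (lam k - 1) • y k - xstar‖ ^ 2 ≤
      μ / 2 * ‖x 0 - xstar‖ ^ 2 + ∑ i ∈ Finset.range (k + 1), lam i ^ 2 * eps i := by
    intro k
    induction k with
    | zero => simpa [h0, hmu0] using hstep 0
    | succ k ih =>
      have hs := hstep (k + 1)
      rw [hextrap k, nesterov_sq_sub_self hrec k] at hs
      have hdec : mu (k + 1) ≤ mu k := hmudec (k + 1) (Nat.le_add_left 1 k)
      have hmono := mul_le_mul_of_nonneg_right hdec
        (sq_nonneg ‖lam k • y (k + 1) - (lam k - 1) • y k - xstar‖)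
      rw [Finset.sum_range_succ]
      linarith
  rintro (_ | k) hk
  · omega
  have hμ : 0 < μ := hmu0 ▸ hmu 0
  have hpos : 0 < lam k := by linarith [hone k]
  have hbound : lam k ^ 2 * (f (y (k + 1)) - f xstar) ≤
      μ / 2 * ‖x 0 - xstar‖ ^ 2 + ∑ i ∈ Finset.range (k + 1), lam i ^ 2 * eps i := by
    have hw : 0 ≤ mu k / 2 * ‖lam k • y (k + 1) - (lam k - 1) • y k - xstar‖ ^ 2 :=
      mul_nonneg (half_pos (hmu k)).le (sq_nonneg _)
    linarith [hpot k]
  rw [Nat.add_sub_cancel]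
  calc f (y (k + 1)) - f xstar
      ≤ (μ / 2 * ‖x 0 - xstar‖ ^ 2 + ∑ i ∈ Finset.range (k + 1), lam i ^ 2 * eps i) /
          lam k ^ 2 := by
        rw [le_div_iff₀ (by positivity)]
        linarith
    _ = μ / 2 * ‖x 0 - xstar‖ ^ 2 / lam k ^ 2 +
          1 / lam k ^ 2 * ∑ i ∈ Finset.range (k + 1), lam i ^ 2 * eps i := by ring
    _ ≤ μ / 2 * ‖x 0 - xstar‖ ^ 2 / (((k : ℝ) + 2) / 2) ^ 2 +
          1 / lam k ^ 2 * ∑ i ∈ Finset.range (k + 1), lam i ^ 2 * eps i := by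
        gcongr
        exact hlb k
    _ = _ := by
        push_cast
        field_simp
        ring
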